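/- Let G with list assignment L and precolored path P be a minimal counterexample configuration for the precolored-path 5-choosability theorem. Then every triangle in G bounds a face of the plane drawing of G; equivalently, for every triangle T in G, no vertex of G lies in the open disc bounded by T. -/

import Mathlib

open Set

noncomputable section

/-- A drawing of a simple graph in the plane: vertices are mapped to distinct points,
each edge is realized by a simple arc joining the images of its endpoints, arcs do not
pass through vertex points, any two arcs realizing distinct edges meet in at most one
point, and no point of the plane that is not a vertex point lies on three or more arcs. -/
structure Drawing {V : Type} (G : SimpleGraph V) where
  pos : V → ℝ × ℝ
  pos_inj : Function.Injective pos
  arc : ∀ ⦃u v : V⦄, G.Adj u v → Path (pos u) (pos v)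
  arc_symm : ∀ ⦃u v : V⦄ (h : G.Adj u v), arc h.symm = (arc h).symm
  arc_inj : ∀ ⦃u v : V⦄ (h : G.Adj u v), Function.Injective ⇑(arc h)
  arc_vertex : ∀ ⦃u v : V⦄ (h : G.Adj u v) (t : unitInterval) (w : V),
    arc h t = pos w → t = 0 ∨ t = 1
  arc_meet_once : ∀ ⦃u v x y : V⦄ (h₁ : G.Adj u v) (h₂ : G.Adj x y),
    s(u, v) ≠ s(x, y) → (Set.range ⇑(arc h₁) ∩ Set.range ⇑(arc h₂)).Subsingleton
  arc_no_triple : ∀ ⦃u₁ v₁ u₂ v₂ u₃ v₃ : V⦄ (h₁ : G.Adj u₁ v₁) (h₂ : G.Adj u₂ v₂)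
    (h₃ : G.Adj u₃ v₃), s(u₁, v₁) ≠ s(u₂, v₂) → s(u₁, v₁) ≠ s(u₃, v₃) →
    s(u₂, v₂) ≠ s(u₃, v₃) →
    ∀ p ∈ Set.range ⇑(arc h₁) ∩ Set.range ⇑(arc h₂) ∩ Set.range ⇑(arc h₃),
      ∃ w : V, p = pos w

namespace Drawing

variable {V : Type} {G : SimpleGraph V} (D : Drawing G)

/-- The set of points used by the arc of an edge. -/
def arcSet ⦃u v : V⦄ (h : G.Adj u v) : Set (ℝ × ℝ) :=
  Set.range ⇑(D.arc h)

/-- The set of interior points of the arc of an edge. -/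
def arcInterior ⦃u v : V⦄ (h : G.Adj u v) : Set (ℝ × ℝ) :=
  ⇑(D.arc h) '' {t : unitInterval | t ≠ 0 ∧ t ≠ 1}

/-- All points of the plane used by the drawing. -/
def graphSet : Set (ℝ × ℝ) :=
  Set.range D.pos ∪ ⋃ (u : V) (v : V) (h : G.Adj u v), D.arcSet h

/-- A crossing of a drawing: a point interior to the arcs of two distinct edges. -/
def IsCrossing (p : ℝ × ℝ) : Prop :=
  ∃ (u v x y : V) (h₁ : G.Adj u v) (h₂ : G.Adj x y),
    s(u, v) ≠ s(x, y) ∧ p ∈ D.arcInterior h₁ ∧ p ∈ D.arcInterior h₂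

/-- A drawing is plane if it has no crossings. -/
def IsPlane : Prop := ∀ p : ℝ × ℝ, ¬ D.IsCrossing p

/-- The faces of a drawing are the connected components of the complement
of the drawing. -/
def IsFace (f : Set (ℝ × ℝ)) : Prop :=
  ∃ q : ℝ × ℝ, q ∉ D.graphSet ∧ f = connectedComponentIn D.graphSetᶜ q

/-- The outer (unbounded) face of a drawing. -/
def outerFace : Set (ℝ × ℝ) :=
  {p : ℝ × ℝ | p ∉ D.graphSet ∧
    ¬ Bornology.IsBounded (connectedComponentIn D.graphSetᶜ p)}

/-- A vertex lies on the outer face if its point is on the boundary of the outer face. -/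
def OnOuter (v : V) : Prop := D.pos v ∈ frontier D.outerFace

/-- The set of points of the plane used by the drawing of a walk. -/
def walkSet {a b : V} (W : G.Walk a b) : Set (ℝ × ℝ) :=
  D.pos '' {v : V | v ∈ W.support} ∪ ⋃ d ∈ W.darts, D.arcSet d.adj

/-- A closed walk bounds the outer face if the boundary of the outer face is exactly
the drawing of the walk. -/
def BoundsOuter {a : V} (W : G.Walk a a) : Prop :=
  frontier D.outerFace = D.walkSet W

end Drawing

/-- The open region enclosed by a set `S` (typically the drawing of a cycle):
all points outside `S` whose connected component in the complement of `S` is bounded. -/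
def enclosed (S : Set (ℝ × ℝ)) : Set (ℝ × ℝ) :=
  {p : ℝ × ℝ | p ∉ S ∧ Bornology.IsBounded (connectedComponentIn Sᶜ p)}

namespace Drawing

variable {V : Type} {G : SimpleGraph V} (D : Drawing G)

/-- The closed disc bounded by (the drawing of) a closed walk. -/
def closedDisc {a : V} (W : G.Walk a a) : Set (ℝ × ℝ) :=
  D.walkSet W ∪ enclosed (D.walkSet W)

/-- The endpoints of the (two) edges incident with a crossing point `p`. -/
def crossingEnds (p : ℝ × ℝ) : Set V :=
  {w : V | ∃ (z : V) (h : G.Adj w z), p ∈ D.arcInterior h}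

end Drawing

/-- A proper colouring of `G` from the lists `L`. -/
def IsListColoring {V : Type} (G : SimpleGraph V) (L : V → Finset ℕ) (c : V → ℕ) : Prop :=
  (∀ v, c v ∈ L v) ∧ ∀ ⦃u v : V⦄, G.Adj u v → c u ≠ c v

/-- `G` is colourable from the lists `L`. -/
def ListColorable {V : Type} (G : SimpleGraph V) (L : V → Finset ℕ) : Prop :=
  ∃ c : V → ℕ, IsListColoring G L c


/-- A counterexample configuration for the precolored-path 5-choosability theorem:
a plane graph `G` (on vertex set `Fin n`), a path `P` of length at most two contained in
the boundary of the outer face, and a list assignment `L` satisfying conditions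
(i)–(vi) of the theorem, such that `G` is not `L`-colorable. -/
structure Config where
  n : ℕ
  G : SimpleGraph (Fin n)
  D : Drawing G
  plane : D.IsPlane
  a : Fin n
  b : Fin n
  P : G.Walk a b
  P_path : P.IsPath
  P_len : P.length ≤ 2
  P_boundary : D.walkSet P ⊆ frontier D.outerFace
  L : Fin n → Finset ℕ
  size5 : ∀ v, ¬ D.OnOuter v → 5 ≤ (L v).card
  size3 : ∀ v, D.OnOuter v → v ∉ P.support → 3 ≤ (L v).card
  size1 : ∀ v ∈ P.support, (L v).card = 1
  no_adjacent_3 : ∀ u v, G.Adj u v → (L u).card = 3 → (L v).card ≠ 3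
  proper_on_P : ∀ u ∈ P.support, ∀ v ∈ P.support, G.Adj u v → L u ≠ L v
  common_neighbor : ∀ p₀ p₁ p₂ : Fin n, P.support = [p₀, p₁, p₂] →
    ∀ x, G.Adj x p₀ → G.Adj x p₁ → G.Adj x p₂ → L x ≠ L p₀ ∪ L p₁ ∪ L p₂
  not_colorable : ¬ ListColorable G L

/-- The number of vertices plus the number of edges of a configuration. -/
def Config.size (C : Config) : ℕ := C.n + C.G.edgeSet.ncard

/-- The length of the precolored path of a configuration. -/
def Config.plen (C : Config) : ℕ := C.P.length

/-- The total size of the lists of a configuration. -/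
def Config.lsize (C : Config) : ℕ := ∑ v : Fin C.n, (C.L v).card

/-- A minimal counterexample configuration: `|V(G)| + |E(G)|` is minimum, subject to
that the precolored path is as long as possible, and subject to that the total size of
the lists is minimum. -/
def Config.Minimal (C : Config) : Prop :=
  (∀ C' : Config, C.size ≤ C'.size) ∧
  (∀ C' : Config, C'.size = C.size → C'.plen ≤ C.plen) ∧
  (∀ C' : Config, C'.size = C.size → C'.plen = C.plen → C.lsize ≤ C'.lsize)


/-! ### Topology: continuous logarithms and non-separation -/

/-- Every nonvanishing continuous function on `K` has a continuous logarithm. -/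
def HasLog {X : Type} [TopologicalSpace X] (K : Set X) : Prop :=
  ∀ f : X → ℂ, ContinuousOn f K → (∀ z ∈ K, f z ≠ 0) →
    ∃ g : X → ℂ, ContinuousOn g K ∧ ∀ z ∈ K, Complex.exp (g z) = f z

theorem exists_log_of_simplyConnected {A : Type} [TopologicalSpace A] [SimplyConnectedSpace A]
    [LocallyPathConnectedSpace A] (f : A → ℂ) (hf : Continuous f) (h0 : ∀ a, f a ≠ 0) :
    ∃ g : A → ℂ, Continuous g ∧ ∀ a, Complex.exp (g a) = f a := by
  have a₀ : A := Classical.choice inferInstance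
  let F : C(A, {z : ℂ // z ≠ 0}) := ⟨fun a => ⟨f a, h0 a⟩, by fun_prop⟩
  obtain ⟨H, ⟨-, hH⟩, -⟩ := Complex.isCoveringMap_exp.existsUnique_continuousMap_lifts F a₀
    (Complex.log (f a₀)) (Subtype.ext (Complex.exp_log (h0 a₀)))
  exact ⟨H, H.continuous, fun a => congrArg Subtype.val (congrFun hH a)⟩

theorem HasLog.union {X : Type} [TopologicalSpace X] {K₁ K₂ : Set X} (h₁ : HasLog K₁)
    (h₂ : HasLog K₂) (c₁ : IsClosed K₁) (c₂ : IsClosed K₂) (q : X)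
    (hq₁ : q ∈ K₁) (hq₂ : q ∈ K₂) (hq : ∀ z ∈ K₁, z ∈ K₂ → z = q) : HasLog (K₁ ∪ K₂) := by
  classical
  intro f hf h0
  obtain ⟨g₁, hg₁, e₁⟩ := h₁ f (hf.mono subset_union_left) (fun z hz => h0 z (Or.inl hz))
  obtain ⟨g₂, hg₂, e₂⟩ := h₂ f (hf.mono subset_union_right) (fun z hz => h0 z (Or.inr hz))
  let g : X → ℂ := fun z => if z ∈ K₁ then g₁ z else g₂ z + (g₁ q - g₂ q)
  have E₁ : EqOn g g₁ K₁ := fun z hz => by simp [g, hz]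
  have E₂ : EqOn g (fun z => g₂ z + (g₁ q - g₂ q)) K₂ := by
    intro z hz
    by_cases hz1 : z ∈ K₁
    · have := hq z hz1 hz
      subst this
      simp [g, hz1]
    · simp [g, hz1]
  refine ⟨g, ContinuousOn.union_of_isClosed (hg₁.congr E₁) ((hg₂.add continuousOn_const).congr E₂) c₁ c₂, ?_⟩
  rintro z (hz | hz)
  · rw [E₁ hz, e₁ z hz]
  · rw [E₂ hz]
    simp only [Complex.exp_add, Complex.exp_sub, e₂ z hz, e₁ q hq₁, e₂ q hq₂]
    rw [div_self (h0 q (Or.inl hq₁)), mul_one]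

theorem hasLog_arc {X : Type} [TopologicalSpace X] [T2Space X] (γ : unitInterval → X)
    (hc : Continuous γ) (hi : Function.Injective γ) (s t : unitInterval) (hst : s ≤ t) :
    HasLog (γ '' Icc s t) := by
  intro f hf h0
  let h : ℝ → ℂ := fun u => f (γ (projIcc s t hst (projIcc 0 1 zero_le_one u)))
  have hh : Continuous h := by
    apply hf.comp_continuous
    · exact hc.comp (continuous_subtype_val.comp (continuous_projIcc.comp continuous_projIcc))
    · intro u
      exact mem_image_of_mem _ (projIcc s t hst _).2
  obtain ⟨H, Hc, He⟩ := exists_log_of_simplyConnected h hh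
    (fun u => h0 _ (mem_image_of_mem _ (projIcc s t hst _).2))
  have emb : Topology.IsClosedEmbedding γ := hc.isClosedEmbedding hi
  refine ⟨fun z => H (Function.invFun γ z : unitInterval), ?_, ?_⟩
  · have : ContinuousOn (fun z => H (Function.invFun γ z : unitInterval)) (range γ) := by
      rw [continuousOn_iff_continuous_domRestrict]
      have : (range γ).domRestrict (fun z => H (Function.invFun γ z : unitInterval)) =
          fun z => H (emb.isEmbedding.toHomeomorph.symm z) := by
        funext z
        obtain ⟨z, u, rfl⟩ := z
        have : emb.isEmbedding.toHomeomorph.symm ⟨γ u, u, rfl⟩ = u := by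
          rw [Homeomorph.symm_apply_eq]; rfl
        simp [this, Function.leftInverse_invFun hi u]
      rw [this]
      exact Hc.comp (continuous_subtype_val.comp (Homeomorph.continuous _))
    exact this.mono (image_subset_range _ _)
  · rintro _ ⟨u, hu, rfl⟩
    simp only [Function.leftInverse_invFun hi u, He, h]
    rw [projIcc_val, projIcc_of_mem hst hu]

theorem frontier_component_subset {X : Type} [TopologicalSpace X] [LocallyConnectedSpace X]
    {K : Set X} (hK : IsClosed K) (p : X) : frontier (connectedComponentIn Kᶜ p) ⊆ K := by
  intro z hz
  by_contra hzK
  have hz' : z ∈ Kᶜ := hzK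
  have ho : IsOpen (connectedComponentIn Kᶜ z) := hK.isOpen_compl.connectedComponentIn
  obtain ⟨w, hw1, hw2⟩ := mem_closure_iff.1 hz.1 _ ho (mem_connectedComponentIn hz')
  have e : connectedComponentIn Kᶜ p = connectedComponentIn Kᶜ z :=
    (connectedComponentIn_eq hw2).trans (connectedComponentIn_eq hw1).symm
  rw [e, ho.frontier_eq] at hz
  exact hz.2 (mem_connectedComponentIn hz')

theorem not_bounded_component_of_hasLog {K : Set (ℝ × ℝ)} (hK : IsClosed K) (hl : HasLog K)
    (p : ℝ × ℝ) (hp : p ∉ K) : ¬ Bornology.IsBounded (connectedComponentIn Kᶜ p) := by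
  classical
  intro hb
  set U := connectedComponentIn Kᶜ p with hU
  let e : ℝ × ℝ → ℂ := fun z => Complex.equivRealProdCLM.symm z
  have ec : Continuous e := Complex.equivRealProdCLM.symm.continuous
  have ei : Function.Injective e := Complex.equivRealProdCLM.symm.injective
  have hpU : p ∈ U := mem_connectedComponentIn hp
  let f : ℝ × ℝ → ℂ := fun z => e z - e p
  have fc : Continuous f := ec.sub continuous_const
  have f0 : ∀ z, z ≠ p → f z ≠ 0 := fun z hz h => hz (ei (sub_eq_zero.1 h))
  obtain ⟨g, hg, ge⟩ := hl f fc.continuousOn (fun z hz => f0 z (fun h => hp (h ▸ hz)))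
  obtain ⟨G, hG⟩ := ContinuousMap.exists_restrict_eq hK
    (⟨K.domRestrict g, continuousOn_iff_continuous_domRestrict.1 hg⟩ : C(K, ℂ))
  have hG' : ∀ z ∈ K, G z = g z := fun z hz => congrArg (fun (φ : C(K, ℂ)) => φ ⟨z, hz⟩) hG
  let F : ℝ × ℝ → ℂ := fun z => if z ∈ U then Complex.exp (G z) else f z
  have Fc : Continuous F := by
    apply Continuous.if
    · intro z hz
      have hzK := frontier_component_subset hK p hz
      rw [hG' z hzK, ge z hzK]
    · exact Complex.continuous_exp.comp G.continuous
    · exact fc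
  have F0 : ∀ z, F z ≠ 0 := by
    intro z
    by_cases hz : z ∈ U
    · simp [F, hz]
    · simp only [F, hz, if_false]
      exact f0 z (fun h => hz (h ▸ hpU))
  obtain ⟨H, Hc, He⟩ := exists_log_of_simplyConnected F Fc F0
  obtain ⟨R, hR⟩ := hb.subset_ball p
  let R' : ℝ := 2 * (|R| + 1)
  have hR' : 0 < R' := by positivity
  let c : ℝ → ℝ × ℝ := fun θ => Complex.equivRealProdCLM (e p + R' * Complex.exp (θ * Complex.I))
  have cc : Continuous c := by fun_prop
  have ce : ∀ θ, e (c θ) = e p + R' * Complex.exp (θ * Complex.I) := fun θ => by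
    simp only [e, c, ContinuousLinearEquiv.symm_apply_apply]
  have cU : ∀ θ, c θ ∉ U := by
    intro θ h
    have h1 := hR h
    rw [Metric.mem_ball, dist_eq_norm] at h1
    have h2 : ‖e (c θ - p)‖ = R' := by
      have : e (c θ - p) = e (c θ) - e p := by simp [e]
      rw [this, ce, add_sub_cancel_left, norm_mul, Complex.norm_exp_ofReal_mul_I]
      simp [abs_of_pos hR']
    have h3 : ‖e (c θ - p)‖ ≤ 2 * ‖c θ - p‖ := by
      generalize c θ - p = w
      have h4 := Complex.norm_le_abs_re_add_abs_im (e w)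
      have h5 : (e w).re = w.1 := by simp [e]
      have h6 : (e w).im = w.2 := by simp [e]
      have h7 := norm_fst_le w
      have h8 := norm_snd_le w
      rw [Real.norm_eq_abs] at h7 h8
      rw [h5, h6] at h4
      linarith
    have := le_abs_self R
    simp only [R'] at h2
    linarith
  have key : ∀ θ : ℝ, Complex.exp (H (c θ) - θ * Complex.I) = R' := by
    intro θ
    have : F (c θ) = R' * Complex.exp (θ * Complex.I) := by
      simp only [F, cU θ, if_false, f, ce, add_sub_cancel_left]
    rw [Complex.exp_sub, He, this, mul_div_assoc, div_self (Complex.exp_ne_zero _), mul_one]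
  let k : ℝ → ℂ := fun θ => H (c θ) - θ * Complex.I
  have kc : Continuous k := by fun_prop
  have kconst : ∀ θ, k θ = k 0 := by
    have hcov := Complex.isCoveringMap_exp
    have := hcov.eq_of_comp_eq (A := ℝ) (g₁ := k) (g₂ := fun _ => k 0) kc continuous_const
      (by funext θ; apply Subtype.ext; simp only [Function.comp, k]; rw [key, key]) 0 rfl
    exact fun θ => congrFun this θ
  have h1 := kconst (2 * Real.pi)
  have h2 : c (2 * Real.pi) = c 0 := by
    simp [c, Complex.exp_two_pi_mul_I]
  simp only [k, h2] at h1
  have : (Real.pi : ℂ) = 0 := by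
    have h3 : (2 * Real.pi : ℂ) * Complex.I = 0 := by
      simpa using h1
    simpa using h3
  exact Real.pi_ne_zero (by exact_mod_cast this)

/-- The exterior of a set. -/
def exterior (S : Set (ℝ × ℝ)) : Set (ℝ × ℝ) :=
  {p : ℝ × ℝ | p ∉ S ∧ ¬ Bornology.IsBounded (connectedComponentIn Sᶜ p)}

theorem isOpen_enclosed {S : Set (ℝ × ℝ)} (hS : IsClosed S) : IsOpen (enclosed S) := by
  rw [isOpen_iff_mem_nhds]
  rintro p ⟨hp, hb⟩
  have ho : IsOpen (connectedComponentIn Sᶜ p) := hS.isOpen_compl.connectedComponentIn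
  filter_upwards [ho.mem_nhds (mem_connectedComponentIn hp)] with z hz
  exact ⟨connectedComponentIn_subset _ _ hz, by rwa [← connectedComponentIn_eq hz]⟩

theorem isOpen_exterior {S : Set (ℝ × ℝ)} (hS : IsClosed S) : IsOpen (exterior S) := by
  rw [isOpen_iff_mem_nhds]
  rintro p ⟨hp, hb⟩
  have ho : IsOpen (connectedComponentIn Sᶜ p) := hS.isOpen_compl.connectedComponentIn
  filter_upwards [ho.mem_nhds (mem_connectedComponentIn hp)] with z hz
  exact ⟨connectedComponentIn_subset _ _ hz, by rwa [← connectedComponentIn_eq hz]⟩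

theorem exterior_of_norm {S : Set (ℝ × ℝ)} {R : ℝ} (hR0 : 0 < R) (hR : ∀ z ∈ S, ‖z‖ ≤ R)
    (q : ℝ × ℝ) (hq : R < ‖q‖) : q ∈ exterior S := by
  have hqS : q ∉ S := fun h => absurd (hR q h) (not_le.2 hq)
  refine ⟨hqS, fun hb => ?_⟩
  let ray : Set (ℝ × ℝ) := (fun t : ℝ => t • q) '' Ici 1
  have hray : IsPreconnected ray := isPreconnected_Ici.image _ (by fun_prop)
  have hsub : ray ⊆ Sᶜ := by
    rintro _ ⟨t, ht, rfl⟩ h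
    have := hR _ h
    have ht' : (1 : ℝ) ≤ t := ht
    simp only [norm_smul, Real.norm_eq_abs] at this
    rw [abs_of_nonneg (by linarith)] at this
    nlinarith
  have h1 : ray ⊆ connectedComponentIn Sᶜ q :=
    hray.subset_connectedComponentIn ⟨1, by simp, by simp⟩ hsub
  obtain ⟨M, hM⟩ := (hb.subset h1).exists_norm_le
  have h2 : |M| / ‖q‖ + 1 ∈ Ici (1 : ℝ) := by
    simp only [mem_Ici, le_add_iff_nonneg_left]; positivity
  have h3 := hM _ ⟨_, h2, rfl⟩
  have hq0 : 0 < ‖q‖ := by linarith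
  simp only [norm_smul, Real.norm_eq_abs] at h3
  rw [abs_of_nonneg (by positivity), add_mul, div_mul_cancel₀ _ hq0.ne'] at h3
  have := le_abs_self M
  linarith

/-- If removing part of `J` near `p` leaves a set with continuous logarithms, and `J` encloses
something, then the removed part touches the exterior. -/
theorem touches_exterior {J B N : Set (ℝ × ℝ)} (hJ : IsCompact J) (hB : IsClosed B)
    (hBl : HasLog B) (hBJ : B ⊆ J) (hN : IsOpen N) (hJN : ∀ z ∈ J, z ∉ B → z ∈ N)
    (x : ℝ × ℝ) (hx : x ∈ enclosed J) : (N ∩ exterior J).Nonempty := by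
  by_contra hne
  obtain ⟨R, hR⟩ := hJ.isBounded.exists_norm_le
  have hR' : ∀ z ∈ J, ‖z‖ ≤ |R| + 1 := fun z hz => by
    have := hR z hz; have := le_abs_self R; linarith
  have hxB : x ∉ B := fun h => hx.1 (hBJ h)
  have hW := not_bounded_component_of_hasLog hB hBl x hxB
  set W := connectedComponentIn Bᶜ x
  have hWc : IsPreconnected W := isPreconnected_connectedComponentIn
  have : ∃ y ∈ W, |R| + 1 < ‖y‖ := by
    by_contra! h
    exact hW ((Metric.isBounded_closedBall (x := (0 : ℝ × ℝ)) (r := |R| + 1)).subset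
      (fun y hy => by simpa using h y hy))
  obtain ⟨y, hyW, hy⟩ := this
  have hyE := exterior_of_norm (by positivity) hR' y hy
  have hcov : W ⊆ exterior J ∪ (closure (exterior J))ᶜ := by
    intro z hz
    by_cases h1 : z ∈ exterior J
    · exact Or.inl h1
    right
    intro h2
    have hzB : z ∉ B := connectedComponentIn_subset _ _ hz
    by_cases hzJ : z ∈ J
    · have hzN := hJN z hzJ hzB
      exact hne (mem_closure_iff.1 h2 N hN hzN)
    · have hze : z ∈ enclosed J := ⟨hzJ, by
        by_contra h; exact h1 ⟨hzJ, h⟩⟩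
      obtain ⟨w, hw1, hw2⟩ := mem_closure_iff.1 h2 _ (isOpen_enclosed hJ.isClosed) hze
      exact hw2.2 hw1.2
  have hxc : x ∉ closure (exterior J) := by
    intro h2
    obtain ⟨w, hw1, hw2⟩ := mem_closure_iff.1 h2 _ (isOpen_enclosed hJ.isClosed) hx
    exact hw2.2 hw1.2
  obtain ⟨w, -, hw1, hw2⟩ := hWc _ _ (isOpen_exterior hJ.isClosed) isClosed_closure.isOpen_compl
    hcov ⟨y, hyW, hyE⟩ ⟨x, mem_connectedComponentIn hxB, hxc⟩
  exact hw2 (subset_closure hw1)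

/-- Every point of an arc of a theta-like closed curve made of three arcs lies in the closure
of the exterior. -/
theorem arc_subset_closure_exterior {γ : unitInterval → ℝ × ℝ} (hγ : Continuous γ)
    (hγi : Function.Injective γ) {A B : Set (ℝ × ℝ)} (hA : IsCompact A) (hB : IsCompact B)
    (hAl : HasLog A) (hBl : HasLog B) (c : ℝ × ℝ) (hcA : c ∈ A) (hcB : c ∈ B)
    (hAB : ∀ z ∈ A, z ∈ B → z = c)
    (hA1 : γ 1 ∈ A) (hAγ : ∀ t, γ t ∈ A → t = 1)
    (hB0 : γ 0 ∈ B) (hBγ : ∀ t, γ t ∈ B → t = 0)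
    (x : ℝ × ℝ) (hx : x ∈ enclosed (range γ ∪ A ∪ B)) :
    range γ ⊆ closure (exterior (range γ ∪ A ∪ B)) := by
  have hIoo : ∀ t ∈ Ioo (0 : unitInterval) 1, γ t ∈ closure (exterior (range γ ∪ A ∪ B)) := by
    intro t ht
    rw [mem_closure_iff]
    intro N hN htN
    have hmem : γ ⁻¹' N ∩ Ioo 0 1 ∈ nhds t :=
      Filter.inter_mem ((hN.preimage hγ).mem_nhds htN) (Ioo_mem_nhds ht.1 ht.2)
    obtain ⟨l, u, hlu, hlu'⟩ := (mem_nhds_iff_exists_Ioo_subset' ⟨0, ht.1⟩ ⟨1, ht.2⟩).1 hmem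
    -- shrink
    let B' := ((γ '' Icc 0 l ∪ B) ∪ A) ∪ γ '' Icc u 1
    have c1 : IsClosed (γ '' Icc 0 l) := (isCompact_Icc.image hγ).isClosed
    have c2 : IsClosed (γ '' Icc u 1) := (isCompact_Icc.image hγ).isClosed
    have hl1 : l < 1 := hlu.1.trans ht.2
    have hu0 : 0 < u := ht.1.trans hlu.2
    have hul : l < u := hlu.1.trans hlu.2
    have L1 : HasLog (γ '' Icc 0 l ∪ B) := by
      refine (hasLog_arc γ hγ hγi 0 l (unitInterval.nonneg' )).union hBl c1 hB.isClosed (γ 0)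
        (mem_image_of_mem _ ⟨le_rfl, unitInterval.nonneg'⟩) hB0 ?_
      rintro _ ⟨s, hs, rfl⟩ h
      rw [hBγ s h]
    have L2 : HasLog ((γ '' Icc 0 l ∪ B) ∪ A) := by
      refine L1.union hAl (c1.union hB.isClosed) hA.isClosed c (Or.inr hcB) hcA ?_
      rintro z (⟨s, hs, rfl⟩ | hz) h
      · have := hAγ s h
        subst this
        exact absurd hs.2 (not_le.2 hl1)
      · exact hAB z h hz
    have L3 : HasLog B' := by
      refine L2.union (hasLog_arc γ hγ hγi u 1 unitInterval.le_one')
        ((c1.union hB.isClosed).union hA.isClosed) c2 (γ 1) (Or.inr hA1)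
        (mem_image_of_mem _ ⟨unitInterval.le_one', le_rfl⟩) ?_
      rintro z ((⟨s, hs, rfl⟩ | hz) | hz) ⟨s', hs', e⟩
      · have := hγi e
        subst this
        exact absurd (hs'.1.trans hs.2) (not_le.2 hul)
      · subst e
        have := hBγ s' hz
        subst this
        exact absurd hs'.1 (not_le.2 hu0)
      · subst e
        rw [hAγ s' hz]
    refine touches_exterior (((isCompact_range hγ).union hA).union hB)
      (((c1.union hB.isClosed).union hA.isClosed).union c2) L3 ?_ hN ?_ x hx
    · rintro z (((⟨s, hs, rfl⟩ | hz) | hz) | ⟨s, hs, rfl⟩)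
      · exact Or.inl (Or.inl ⟨s, rfl⟩)
      · exact Or.inr hz
      · exact Or.inl (Or.inr hz)
      · exact Or.inl (Or.inl ⟨s, rfl⟩)
    · rintro z ((⟨s, rfl⟩ | hz) | hz) hzB
      · have h1 : l < s := by
          by_contra! h
          exact hzB (Or.inl (Or.inl (Or.inl ⟨s, ⟨unitInterval.nonneg', h⟩, rfl⟩)))
        have h2 : s < u := by
          by_contra! h
          exact hzB (Or.inr ⟨s, ⟨h, unitInterval.le_one'⟩, rfl⟩)
        exact (hlu' ⟨h1, h2⟩).1
      · exact absurd (Or.inl (Or.inr hz)) hzB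
      · exact absurd (Or.inl (Or.inl (Or.inr hz))) hzB
  have hcl : closure (Ioo (0 : unitInterval) 1) = Icc 0 1 := closure_Ioo zero_ne_one
  rintro _ ⟨t, rfl⟩
  have ht : t ∈ closure (Ioo (0 : unitInterval) 1) := by
    rw [hcl]; exact ⟨unitInterval.nonneg', unitInterval.le_one'⟩
  have := map_mem_closure hγ ht hIoo
  rwa [closure_closure] at this

/-! ### Subdrawings -/

/-- The restriction of a drawing along an injective vertex map. -/
def Drawing.pull {V W : Type} {G : SimpleGraph V} (D : Drawing G) {H : SimpleGraph W}
    (f : W → V) (hf : Function.Injective f)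
    (hom : ∀ ⦃u v : W⦄, H.Adj u v → G.Adj (f u) (f v)) : Drawing H where
  pos := fun w => D.pos (f w)
  pos_inj := D.pos_inj.comp hf
  arc := fun _ _ h => D.arc (hom h)
  arc_symm := fun _ _ h => D.arc_symm (hom h)
  arc_inj := fun _ _ h => D.arc_inj (hom h)
  arc_vertex := fun _ _ h t w e => D.arc_vertex (hom h) t (f w) e
  arc_meet_once := by
    intro u v x y h₁ h₂ hne
    apply D.arc_meet_once (hom h₁) (hom h₂)
    intro e
    exact hne (Sym2.map.injective hf (by simpa using e))
  arc_no_triple := by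
    intro u₁ v₁ u₂ v₂ u₃ v₃ h₁ h₂ h₃ n12 n13 n23 p hp
    have N : ∀ {a b c d : W}, s(a, b) ≠ s(c, d) → s(f a, f b) ≠ s(f c, f d) := by
      intro a b c d hne e
      exact hne (Sym2.map.injective hf (by simpa using e))
    obtain ⟨⟨⟨t, ht⟩, ⟨s, hs⟩⟩, ⟨r, hr⟩⟩ := hp
    obtain ⟨w, hw⟩ := D.arc_no_triple (hom h₁) (hom h₂) (hom h₃) (N n12) (N n13) (N n23) p
      ⟨⟨⟨t, ht⟩, ⟨s, hs⟩⟩, ⟨r, hr⟩⟩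
    have ht' : D.arc (hom h₁) t = D.pos w := ht.trans hw
    rcases D.arc_vertex (hom h₁) t w ht' with h | h
    · subst h
      exact ⟨u₁, by rw [← ht]; exact (D.arc (hom h₁)).source⟩
    · subst h
      exact ⟨v₁, by rw [← ht]; exact (D.arc (hom h₁)).target⟩

section pull

variable {V W : Type} {G : SimpleGraph V} (D : Drawing G) {H : SimpleGraph W}
    (f : W → V) (hf : Function.Injective f)
    (hom : ∀ ⦃u v : W⦄, H.Adj u v → G.Adj (f u) (f v))

theorem pull_plane (hD : D.IsPlane) : (D.pull f hf hom).IsPlane := by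
  rintro p ⟨u, v, x, y, h₁, h₂, hne, hp₁, hp₂⟩
  refine hD p ⟨f u, f v, f x, f y, hom h₁, hom h₂, ?_, hp₁, hp₂⟩
  intro e
  exact hne (Sym2.map.injective hf (by simpa using e))

theorem pull_graphSet : (D.pull f hf hom).graphSet ⊆ D.graphSet := by
  rintro p (⟨w, rfl⟩ | hp)
  · exact Or.inl ⟨f w, rfl⟩
  · simp only [mem_iUnion] at hp
    obtain ⟨u, v, h, hp⟩ := hp
    right
    simp only [mem_iUnion]
    exact ⟨f u, f v, hom h, hp⟩

theorem pull_outerFace : D.outerFace ⊆ (D.pull f hf hom).outerFace := by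
  rintro p ⟨hp, hb⟩
  have hs := pull_graphSet D f hf hom
  exact ⟨fun h => hp (hs h), fun h => hb (h.subset
    (connectedComponentIn_mono p (compl_subset_compl.2 hs)))⟩

end pull

theorem mem_frontier_of_graphSet {V : Type} {G : SimpleGraph V} (D : Drawing G) {p : ℝ × ℝ}
    (hp : p ∈ D.graphSet) (hc : p ∈ closure D.outerFace) : p ∈ frontier D.outerFace :=
  ⟨hc, fun h => (interior_subset h).1 hp⟩

theorem walkSet_subset_graphSet {V : Type} {G : SimpleGraph V} (D : Drawing G) {a b : V}
    (P : G.Walk a b) : D.walkSet P ⊆ D.graphSet := by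
  rintro p (⟨v, -, rfl⟩ | hp)
  · exact Or.inl ⟨v, rfl⟩
  · simp only [mem_iUnion] at hp
    obtain ⟨d, -, hp⟩ := hp
    right
    simp only [mem_iUnion]
    exact ⟨_, _, d.adj, hp⟩

theorem walkSet_cons {V : Type} {G : SimpleGraph V} (D : Drawing G) {a b c : V} (h : G.Adj a b)
    (P : G.Walk b c) : D.walkSet (.cons h P) = D.arcSet h ∪ D.walkSet P := by
  have h0 : D.pos a ∈ D.arcSet h := ⟨0, (D.arc h).source⟩
  ext p
  simp only [Drawing.walkSet, SimpleGraph.Walk.support_cons, SimpleGraph.Walk.darts_cons,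
    List.mem_cons, mem_union, mem_image, mem_ofPred_eq, mem_iUnion, exists_prop]
  constructor
  · rintro (⟨v, rfl | hv, rfl⟩ | ⟨d, rfl | hd, hp⟩)
    · exact Or.inl h0
    · exact Or.inr (Or.inl ⟨v, hv, rfl⟩)
    · exact Or.inl hp
    · exact Or.inr (Or.inr ⟨d, hd, hp⟩)
  · rintro (hp | ⟨v, hv, rfl⟩ | ⟨d, hd, hp⟩)
    · exact Or.inr ⟨⟨(a, b), h⟩, Or.inl rfl, hp⟩
    · exact Or.inl ⟨v, Or.inr hv, rfl⟩
    · exact Or.inr ⟨d, Or.inr hd, hp⟩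

theorem walkSet_nil {V : Type} {G : SimpleGraph V} (D : Drawing G) (a : V) :
    D.walkSet (.nil : G.Walk a a) = {D.pos a} := by
  simp [Drawing.walkSet]

theorem exists_pull_walk {V W : Type} {G : SimpleGraph V} (D : Drawing G)
    (f : W → V) (hf : Function.Injective f)
    (hom : ∀ ⦃u v : W⦄, (G.comap f).Adj u v → G.Adj (f u) (f v)) {a b : V} (P : G.Walk a b)
    (hP : ∀ v ∈ P.support, v ∈ range f) :
    ∃ (a' b' : W) (P' : (G.comap f).Walk a' b'), f a' = a ∧ P'.support.map f = P.support ∧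
      (D.pull f hf hom).walkSet P' ⊆ D.walkSet P := by
  induction P with
  | @nil u =>
    obtain ⟨a', rfl⟩ := hP u (by simp)
    refine ⟨a', a', .nil, rfl, by simp, ?_⟩
    rw [walkSet_nil, walkSet_nil]
    exact subset_rfl
  | @cons u v w h p ih =>
    obtain ⟨u', rfl⟩ := hP u (by simp)
    obtain ⟨v', b', P', rfl, hs, hw⟩ := ih (fun x hx => hP x (by simp [hx]))
    have h' : (G.comap f).Adj u' v' := h
    refine ⟨u', b', .cons h' P', rfl, by simp [hs], ?_⟩
    rw [walkSet_cons, walkSet_cons]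
    exact union_subset_union subset_rfl hw

theorem exists_enum {n : ℕ} (S : Set (Fin n)) :
    ∃ (m : ℕ) (f : Fin m → Fin n), Function.Injective f ∧ range f = S := by
  classical
  refine ⟨Fintype.card S, fun i => ((Fintype.equivFin S).symm i).1, ?_, ?_⟩
  · exact Subtype.val_injective.comp (Equiv.injective _)
  · ext x
    constructor
    · rintro ⟨i, rfl⟩
      exact Subtype.prop _
    · intro hx
      exact ⟨Fintype.equivFin S ⟨x, hx⟩, by simp⟩

theorem ncard_edges_le {V W : Type} {H : SimpleGraph W} (f : W → V)
    (hf : Function.Injective f) (E : Set (Sym2 V)) (hE : E.Finite)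
    (hom : ∀ ⦃u v : W⦄, H.Adj u v → s(f u, f v) ∈ E) : H.edgeSet.ncard ≤ E.ncard := by
  refine Set.ncard_le_ncard_of_injOn (Sym2.map f) ?_ (Sym2.map.injective hf).injOn hE
  intro e he
  induction e with
  | _ u v => exact hom he

theorem walk_three {V : Type} {G : SimpleGraph V} {r s : V} (T : G.Walk r s)
    (h : T.length = 3) : ∃ (b c : V) (hab : G.Adj r b) (hbc : G.Adj b c) (hca : G.Adj c s),
      T = .cons hab (.cons hbc (.cons hca .nil)) := by
  match T, h with
  | .cons h1 (.cons h2 (.cons h3 .nil)), _ => exact ⟨_, _, h1, h2, h3, rfl⟩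

/-! ### Triangles in plane drawings -/

section triangle

variable {V : Type} {G : SimpleGraph V} (D : Drawing G) {a b c : V}

/-- The point set of a triangle. -/
def triSet (hab : G.Adj a b) (hbc : G.Adj b c) (hca : G.Adj c a) : Set (ℝ × ℝ) :=
  range (D.arc hab) ∪ range (D.arc hbc) ∪ range (D.arc hca)

theorem src_mem {u v : V} (h : G.Adj u v) : D.pos u ∈ range (D.arc h) :=
  ⟨0, (D.arc h).source⟩

theorem tgt_mem {u v : V} (h : G.Adj u v) : D.pos v ∈ range (D.arc h) :=
  ⟨1, (D.arc h).target⟩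

theorem vertex_on_arc {u v w : V} (h : G.Adj u v) (hw : D.pos w ∈ range (D.arc h)) :
    w = u ∨ w = v := by
  obtain ⟨t, ht⟩ := hw
  rcases D.arc_vertex h t w ht with rfl | rfl
  · left; apply D.pos_inj; rw [← ht]; exact (D.arc h).source
  · right; apply D.pos_inj; rw [← ht]; exact (D.arc h).target

theorem hasLog_range {u v : V} (h : G.Adj u v) : HasLog (range (D.arc h)) := by
  have := hasLog_arc (D.arc h) (D.arc h).continuous (D.arc_inj h) 0 1 zero_le_one
  have e : Icc (0 : unitInterval) 1 = univ := by
    ext t; simp [unitInterval.nonneg', unitInterval.le_one']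
  rwa [e, image_univ] at this

theorem adj_meet {u v w : V} (h₁ : G.Adj u v) (h₂ : G.Adj v w) (huw : u ≠ w) (z : ℝ × ℝ)
    (hz₁ : z ∈ range (D.arc h₁)) (hz₂ : z ∈ range (D.arc h₂)) : z = D.pos v := by
  refine D.arc_meet_once h₁ h₂ ?_ ⟨hz₁, hz₂⟩ ⟨tgt_mem D h₁, src_mem D h₂⟩
  intro e
  rw [Sym2.eq_iff] at e
  rcases e with ⟨h, -⟩ | ⟨h, -⟩
  · exact h₁.ne h
  · exact huw h

theorem isCompact_arc {u v : V} (h : G.Adj u v) : IsCompact (range (D.arc h)) :=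
  isCompact_range (D.arc h).continuous

theorem isCompact_triSet (hab : G.Adj a b) (hbc : G.Adj b c) (hca : G.Adj c a) :
    IsCompact (triSet D hab hbc hca) :=
  ((isCompact_arc D hab).union (isCompact_arc D hbc)).union (isCompact_arc D hca)

theorem tri_side_closure (hab : G.Adj a b) (hbc : G.Adj b c) (hca : G.Adj c a) (x : ℝ × ℝ)
    (hx : x ∈ enclosed (triSet D hab hbc hca)) :
    range (D.arc hab) ⊆ closure (exterior (triSet D hab hbc hca)) := by
  refine arc_subset_closure_exterior (D.arc hab).continuous (D.arc_inj hab)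
    (isCompact_arc D hbc) (isCompact_arc D hca) (hasLog_range D hbc) (hasLog_range D hca)
    (D.pos c) (tgt_mem D hbc) (src_mem D hca) ?_ ?_ ?_ ?_ ?_ x hx
  · exact fun z h1 h2 => adj_meet D hbc hca hab.ne' z h1 h2
  · rw [(D.arc hab).target]; exact src_mem D hbc
  · intro t ht
    apply D.arc_inj hab
    rw [(D.arc hab).target]
    exact adj_meet D hab hbc hca.ne' _ ⟨t, rfl⟩ ht
  · rw [(D.arc hab).source]; exact tgt_mem D hca
  · intro t ht
    apply D.arc_inj hab
    rw [(D.arc hab).source]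
    exact adj_meet D hca hab hbc.ne' _ ht ⟨t, rfl⟩

theorem vertex_on_tri (hab : G.Adj a b) (hbc : G.Adj b c) (hca : G.Adj c a) {w : V}
    (hw : D.pos w ∈ triSet D hab hbc hca) : w = a ∨ w = b ∨ w = c := by
  rcases hw with (hw | hw) | hw
  · rcases vertex_on_arc D hab hw with h | h <;> simp [h]
  · rcases vertex_on_arc D hbc hw with h | h <;> simp [h]
  · rcases vertex_on_arc D hca hw with h | h <;> simp [h]

theorem interior_not_tri (hD : D.IsPlane) {u v x y : V} (h : G.Adj u v) (h' : G.Adj x y)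
    (hu : D.pos u ∉ range (D.arc h')) (t : unitInterval) (ht : t ≠ 1) :
    D.arc h t ∉ range (D.arc h') := by
  rintro ⟨s, hs⟩
  by_cases ht0 : t = 0
  · subst ht0
    rw [(D.arc h).source] at hs
    exact hu ⟨s, hs⟩
  by_cases hs0 : s = 0
  · subst hs0
    rw [(D.arc h').source] at hs
    rcases D.arc_vertex h t x hs.symm with h | h
    exacts [ht0 h, ht h]
  by_cases hs1 : s = 1
  · subst hs1
    rw [(D.arc h').target] at hs
    rcases D.arc_vertex h t y hs.symm with h | h
    exacts [ht0 h, ht h]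
  refine hD (D.arc h t) ⟨u, v, x, y, h, h', ?_, ⟨t, ⟨ht0, ht⟩, rfl⟩, ⟨s, ⟨hs0, hs1⟩, hs⟩⟩
  intro e
  rw [Sym2.eq_iff] at e
  rcases e with ⟨rfl, -⟩ | ⟨rfl, -⟩
  · exact hu (src_mem D h')
  · exact hu (tgt_mem D h')

theorem edge_from_enclosed (hD : D.IsPlane) (hab : G.Adj a b) (hbc : G.Adj b c)
    (hca : G.Adj c a) {u v : V} (h : G.Adj u v)
    (hu : D.pos u ∈ enclosed (triSet D hab hbc hca)) :
    range (D.arc h) ⊆ triSet D hab hbc hca ∪ enclosed (triSet D hab hbc hca) := by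
  set J := triSet D hab hbc hca with hJ
  have hnot : ∀ t : unitInterval, t ≠ 1 → D.arc h t ∉ J := by
    rintro t ht ((h1 | h1) | h1)
    · exact interior_not_tri D hD h hab (fun h => hu.1 (Or.inl (Or.inl h))) t ht h1
    · exact interior_not_tri D hD h hbc (fun h => hu.1 (Or.inl (Or.inr h))) t ht h1
    · exact interior_not_tri D hD h hca (fun h => hu.1 (Or.inr h)) t ht h1
  rintro _ ⟨t, rfl⟩
  by_cases htJ : D.arc h t ∈ J
  · exact Or.inl htJ
  right
  have hpre : IsPreconnected (D.arc h '' Icc 0 t) :=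
    isPreconnected_Icc.image _ (D.arc h).continuous.continuousOn
  have hsub : D.arc h '' Icc 0 t ⊆ Jᶜ := by
    rintro _ ⟨s, hs, rfl⟩ hsJ
    by_cases hs1 : s = 1
    · subst hs1
      have : t = 1 := le_antisymm unitInterval.le_one' hs.2
      subst this
      exact htJ hsJ
    · exact hnot s hs1 hsJ
  have h1 := hpre.subset_connectedComponentIn (x := D.pos u)
    ⟨0, ⟨le_rfl, unitInterval.nonneg'⟩, (D.arc h).source⟩ hsub
  have h2 : D.arc h t ∈ connectedComponentIn Jᶜ (D.pos u) :=
    h1 ⟨t, ⟨unitInterval.nonneg', le_rfl⟩, rfl⟩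
  exact ⟨htJ, by rw [← connectedComponentIn_eq h2]; exact hu.2⟩

theorem arc_subset_tri (hab : G.Adj a b) (hbc : G.Adj b c) (hca : G.Adj c a) {u v : V}
    (h : G.Adj u v) (hu : u = a ∨ u = b ∨ u = c) (hv : v = a ∨ v = b ∨ v = c) :
    range (D.arc h) ⊆ triSet D hab hbc hca := by
  intro p hp
  have hsymm : p ∈ range (D.arc h.symm) := by
    rw [D.arc_symm]
    simpa using hp
  rcases hu with rfl | rfl | rfl <;> rcases hv with rfl | rfl | rfl
  · exact (h.ne rfl).elim
  · exact Or.inl (Or.inl hp)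
  · exact Or.inr hsymm
  · exact Or.inl (Or.inl hsymm)
  · exact (h.ne rfl).elim
  · exact Or.inl (Or.inr hp)
  · exact Or.inr hp
  · exact Or.inl (Or.inr hsymm)
  · exact (h.ne rfl).elim

theorem enclosed_not_closure {S : Set (ℝ × ℝ)} (hS : IsClosed S) (hSG : S ⊆ D.graphSet)
    {p : ℝ × ℝ} (hp : p ∈ enclosed S) : p ∉ closure D.outerFace := by
  intro h
  obtain ⟨w, hw1, hw2⟩ := mem_closure_iff.1 h _ (isOpen_enclosed hS) hp
  exact hw2.2 (hw1.2.subset (connectedComponentIn_mono w (compl_subset_compl.2 hSG)))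

theorem exterior_subset_outerFace {J : Set (ℝ × ℝ)} (h : D.graphSet ⊆ J ∪ enclosed J) :
    exterior J ⊆ D.outerFace := by
  have key : ∀ p ∈ exterior J, p ∉ D.graphSet := by
    intro p hp hg
    rcases h hg with h1 | h1
    · exact hp.1 h1
    · exact hp.2 h1.2
  intro p hp
  refine ⟨key p hp, fun hb => hp.2 (hb.subset ?_)⟩
  refine isPreconnected_connectedComponentIn.subset_connectedComponentIn
    (mem_connectedComponentIn hp.1) ?_
  intro q hq
  exact key q ⟨connectedComponentIn_subset _ _ hq, by rw [← connectedComponentIn_eq hq]; exact hp.2⟩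

end triangle

theorem minimal_counterexample_triangles_bound_faces
    (C : Config) (hmin : C.Minimal)
    {r : Fin C.n} (T : C.G.Walk r r) (hTcyc : T.IsCycle) (hTlen : T.length = 3) :
    ∀ x : Fin C.n, C.D.pos x ∉ enclosed (C.D.walkSet T) := by
  classical
  intro x hx
  obtain ⟨b, c, hab, hbc, hca, rfl⟩ := walk_three T hTlen
  have hJ : C.D.walkSet (.cons hab (.cons hbc (.cons hca .nil))) = triSet C.D hab hbc hca := by
    have := tgt_mem C.D hca
    rw [walkSet_cons, walkSet_cons, walkSet_cons, walkSet_nil, triSet, union_assoc]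
    congr 2
    exact union_eq_left.2 (singleton_subset_iff.2 this)
  have hJG : triSet C.D hab hbc hca ⊆ C.D.graphSet := hJ ▸ walkSet_subset_graphSet C.D _
  rw [hJ] at hx
  clear hJ hTcyc hTlen
  set J := triSet C.D hab hbc hca with hJdef
  have hJc : IsClosed J := (isCompact_triSet C.D hab hbc hca).isClosed
  have hJa : C.D.pos r ∈ J := Or.inl (Or.inl (src_mem _ _))
  have hJb : C.D.pos b ∈ J := Or.inl (Or.inl (tgt_mem _ _))
  have hJcc : C.D.pos c ∈ J := Or.inl (Or.inr (tgt_mem _ _))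
  have henc5 : ∀ v, C.D.pos v ∈ enclosed J → 5 ≤ (C.L v).card := fun v hv =>
    C.size5 v (fun h => enclosed_not_closure C.D hJc hJG hv h.1)
  -- Step 1: colour everything outside the triangle.
  have step1 : ∃ c₁ : Fin C.n → ℕ, (∀ v, C.D.pos v ∉ enclosed J → c₁ v ∈ C.L v) ∧
      ∀ u v, C.D.pos u ∉ enclosed J → C.D.pos v ∉ enclosed J → C.G.Adj u v → c₁ u ≠ c₁ v := by
    obtain ⟨m, f, hf, hfr⟩ := exists_enum {v | C.D.pos v ∉ enclosed J}
    have hom : ∀ ⦃u v : Fin m⦄, (C.G.comap f).Adj u v → C.G.Adj (f u) (f v) := fun _ _ h => h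
    have hout : ∀ v, C.D.OnOuter (f v) → (C.D.pull f hf hom).OnOuter v := fun v hv =>
      mem_frontier_of_graphSet _ (Or.inl ⟨v, rfl⟩)
        (closure_mono (pull_outerFace C.D f hf hom) hv.1)
    obtain ⟨a', b', P', -, hPs, hPw⟩ := exists_pull_walk C.D f hf hom C.P (by
      intro v hv
      rw [hfr]
      intro he
      exact enclosed_not_closure C.D hJc hJG he
        (C.P_boundary (Or.inl ⟨v, hv, rfl⟩)).1)
    have hsup : ∀ v, v ∈ P'.support ↔ f v ∈ C.P.support := by
      intro v
      rw [← hPs, List.mem_map_of_injective hf]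
    have hcol : ListColorable (C.G.comap f) (fun v => C.L (f v)) := by
      by_contra hnc
      let C' : Config :=
        { n := m
          G := C.G.comap f
          D := C.D.pull f hf hom
          plane := pull_plane C.D f hf hom C.plane
          a := a'
          b := b'
          P := P'
          P_path := by
            rw [SimpleGraph.Walk.isPath_def]
            apply List.Nodup.of_map f
            rw [hPs]
            exact C.P_path.support_nodup
          P_len := by
            have h1 := congrArg List.length hPs
            rw [List.length_map, SimpleGraph.Walk.length_support,
              SimpleGraph.Walk.length_support] at h1
            have := C.P_len
            omega
          P_boundary := fun p hp => mem_frontier_of_graphSet _ (walkSet_subset_graphSet _ _ hp)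
            (closure_mono (pull_outerFace C.D f hf hom) (C.P_boundary (hPw hp)).1)
          L := fun v => C.L (f v)
          size5 := fun v hv => C.size5 _ (fun h => hv (hout v h))
          size3 := by
            intro v _ hv
            by_cases ho : C.D.OnOuter (f v)
            · exact C.size3 _ ho (fun h => hv ((hsup v).2 h))
            · exact le_trans (by norm_num) (C.size5 _ ho)
          size1 := fun v hv => C.size1 _ ((hsup v).1 hv)
          no_adjacent_3 := fun u v h => C.no_adjacent_3 _ _ (hom h)
          proper_on_P := fun u hu v hv h =>
            C.proper_on_P _ ((hsup u).1 hu) _ ((hsup v).1 hv) (hom h)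
          common_neighbor := fun p₀ p₁ p₂ hp x h0 h1 h2 =>
            C.common_neighbor (f p₀) (f p₁) (f p₂) (by rw [← hPs, hp]; rfl) (f x) h0 h1 h2
          not_colorable := hnc }
      have h1 : C.n + C.G.edgeSet.ncard ≤ m + (C.G.comap f).edgeSet.ncard := hmin.1 C'
      have h2 : (C.G.comap f).edgeSet.ncard ≤ C.G.edgeSet.ncard :=
        ncard_edges_le f hf _ (Set.toFinite _) (fun u v h => h)
      have h3 : m < C.n := by
        have := Fintype.card_lt_of_injective_of_notMem f hf (b := x) (by
          rw [hfr]; exact fun h => h hx)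
        simpa using this
      omega
    obtain ⟨c₁, hc1, hc2⟩ := hcol
    have hinv : ∀ v, C.D.pos v ∉ enclosed J → ∃ i, f i = v := fun v hv => by
      have : v ∈ range f := by rw [hfr]; exact hv
      exact this
    refine ⟨fun v => if h : ∃ i, f i = v then c₁ h.choose else 0, ?_, ?_⟩
    · intro v hv
      have h := hinv v hv
      have e := h.choose_spec
      simp only [h, dif_pos]
      have : c₁ h.choose ∈ C.L (f h.choose) := hc1 h.choose
      rwa [e] at this
    · intro u v hu hv huv
      have h := hinv u hu
      have h' := hinv v hv
      simp only [h, h', dif_pos]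
      apply hc2
      show C.G.Adj _ _
      rw [h.choose_spec, h'.choose_spec]
      exact huv
  obtain ⟨c₁, hc1, hc1'⟩ := step1
  have hna : C.D.pos r ∉ enclosed J := fun h => h.1 hJa
  have hnb : C.D.pos b ∉ enclosed J := fun h => h.1 hJb
  have hnc : C.D.pos c ∉ enclosed J := fun h => h.1 hJcc
  have hTn : ∀ v, (v = r ∨ v = b ∨ v = c) → C.D.pos v ∉ enclosed J := by
    rintro v (rfl | rfl | rfl) <;> assumption
  -- Step 2: colour the inside.
  have step2 : ∃ c₂ : Fin C.n → ℕ, (∀ v, C.D.pos v ∈ enclosed J → c₂ v ∈ C.L v) ∧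
      (∀ v, (v = r ∨ v = b ∨ v = c) → c₂ v = c₁ v) ∧
      ∀ u v, C.D.pos u ∈ enclosed J →
        (C.D.pos v ∈ enclosed J ∨ (v = r ∨ v = b ∨ v = c)) → C.G.Adj u v → c₂ u ≠ c₂ v := by
    obtain ⟨m, f, hf, hfr⟩ :=
      exists_enum {v | C.D.pos v ∈ enclosed J ∨ (v = r ∨ v = b ∨ v = c)}
    have hfm : ∀ i, C.D.pos (f i) ∈ enclosed J ∨ (f i = r ∨ f i = b ∨ f i = c) := fun i => by
      have : f i ∈ range f := ⟨i, rfl⟩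
      rw [hfr] at this
      exact this
    have hinv : ∀ v, (C.D.pos v ∈ enclosed J ∨ (v = r ∨ v = b ∨ v = c)) → ∃ i, f i = v :=
      fun v hv => by
        have : v ∈ range f := by rw [hfr]; exact hv
        exact this
    obtain ⟨a', ha'⟩ := hinv r (by simp)
    obtain ⟨b', hb'⟩ := hinv b (by simp)
    obtain ⟨c', hc'⟩ := hinv c (by simp)
    let H : SimpleGraph (Fin m) :=
      { Adj := fun u v => C.G.Adj (f u) (f v) ∧ s(f u, f v) ≠ s(c, r)
        symm := ⟨fun u v h => ⟨h.1.symm, by rw [Sym2.eq_swap]; exact h.2⟩⟩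
        loopless := ⟨fun u h => h.1.ne rfl⟩ }
    have hom : ∀ ⦃u v : Fin m⦄, H.Adj u v → C.G.Adj (f u) (f v) := fun _ _ h => h.1
    have hab' : H.Adj a' b' := by
      refine ⟨by rw [ha', hb']; exact hab, ?_⟩
      rw [ha', hb', Ne, Sym2.eq_iff]
      rintro (⟨h, -⟩ | ⟨-, h⟩)
      exacts [hca.ne h.symm, hbc.ne h]
    have hbc' : H.Adj b' c' := by
      refine ⟨by rw [hb', hc']; exact hbc, ?_⟩
      rw [hb', hc', Ne, Sym2.eq_iff]
      rintro (⟨h, -⟩ | ⟨h, -⟩)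
      exacts [hbc.ne h, hab.ne h.symm]
    let P' : H.Walk a' c' := .cons hab' (.cons hbc' .nil)
    have hPs : P'.support = [a', b', c'] := rfl
    have hsup : ∀ v, v ∈ P'.support ↔ (f v = r ∨ f v = b ∨ f v = c) := by
      intro v
      rw [hPs, ← ha', ← hb', ← hc']
      simp [hf.eq_iff]
    let L' : Fin m → Finset ℕ := fun v =>
      if f v = r ∨ f v = b ∨ f v = c then {c₁ (f v)} else C.L (f v)
    have hL1 : ∀ v ∈ P'.support, L' v = {c₁ (f v)} := fun v hv => by
      simp only [L', if_pos ((hsup v).1 hv)]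
    have hL5' : ∀ v, v ∉ P'.support → L' v = C.L (f v) := fun v hv => by
      simp only [L', if_neg (fun h => hv ((hsup v).2 h))]
    have hL5 : ∀ v, v ∉ P'.support → 5 ≤ (L' v).card := fun v hv => by
      rw [hL5' v hv]
      rcases hfm v with h | h
      · exact henc5 _ h
      · exact absurd ((hsup v).2 h) hv
    let D' := C.D.pull f hf hom
    have hgs : D'.graphSet ⊆ J ∪ enclosed J := by
      have hpos : ∀ w, D'.pos w ∈ J ∪ enclosed J := by
        intro w
        show C.D.pos (f w) ∈ _
        rcases hfm w with h | h | h | h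
        · exact Or.inr h
        · rw [h]; exact Or.inl hJa
        · rw [h]; exact Or.inl hJb
        · rw [h]; exact Or.inl hJcc
      rintro p (⟨w, rfl⟩ | hp)
      · exact hpos w
      · simp only [mem_iUnion] at hp
        obtain ⟨u, v, h, hp⟩ := hp
        have hp' : p ∈ range (C.D.arc (hom h)) := hp
        rcases hfm u with hu | hu
        · exact edge_from_enclosed C.D C.plane hab hbc hca (hom h) hu hp'
        rcases hfm v with hv | hv
        · refine edge_from_enclosed C.D C.plane hab hbc hca (hom h).symm hv ?_
          rw [C.D.arc_symm]
          simpa using hp'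
        left
        exact arc_subset_tri C.D hab hbc hca (hom h) hu hv hp'
    have hext : exterior J ⊆ D'.outerFace := exterior_subset_outerFace D' hgs
    have hside1 : range (C.D.arc hab) ⊆ closure (exterior J) :=
      tri_side_closure C.D hab hbc hca _ hx
    have hrot : triSet C.D hbc hca hab = J := by
      simp only [hJdef, triSet]
      rw [union_comm, union_assoc]
    have hside2 : range (C.D.arc hbc) ⊆ closure (exterior J) := by
      have := tri_side_closure C.D hbc hca hab (C.D.pos x) (by rw [hrot]; exact hx)
      rwa [hrot] at this
    have hPb : D'.walkSet P' ⊆ frontier D'.outerFace := by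
      intro p hp
      refine mem_frontier_of_graphSet _ (walkSet_subset_graphSet _ _ hp) (closure_mono hext ?_)
      rw [walkSet_cons, walkSet_cons, walkSet_nil] at hp
      have e1 : D'.arcSet hab' = range (C.D.arc hab) := by
        show range (C.D.arc (hom hab')) = _
        subst ha' hb'
        rfl
      have e2 : D'.arcSet hbc' = range (C.D.arc hbc) := by
        show range (C.D.arc (hom hbc')) = _
        subst hb' hc'
        rfl
      rcases hp with hp | hp | hp
      · exact hside1 (e1 ▸ hp)
      · exact hside2 (e2 ▸ hp)
      · apply hside2
        rw [mem_singleton_iff.1 hp]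
        show C.D.pos (f c') ∈ _
        rw [hc']
        exact tgt_mem _ _
    have hcol : ListColorable H L' := by
      by_contra hncol
      let C' : Config :=
        { n := m
          G := H
          D := D'
          plane := pull_plane C.D f hf hom C.plane
          a := a'
          b := c'
          P := P'
          P_path := by
            rw [SimpleGraph.Walk.isPath_def, hPs]
            have : a' ≠ c' := fun h => hca.ne (by rw [← hc', ← ha', h])
            simp [hab'.ne, hbc'.ne, this]
          P_len := le_rfl
          P_boundary := hPb
          L := L'
          size5 := by
            intro v hv
            apply hL5
            intro hvs
            exact hv (hPb (Or.inl ⟨v, hvs, rfl⟩))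
          size3 := fun v _ hv => le_trans (by norm_num) (hL5 v hv)
          size1 := fun v hv => by rw [hL1 v hv]; simp
          no_adjacent_3 := by
            intro u v _ h3 _
            by_cases hu : u ∈ P'.support
            · rw [hL1 u hu] at h3
              simp at h3
            · have := hL5 u hu
              omega
          proper_on_P := by
            intro u hu v hv h
            rw [hL1 u hu, hL1 v hv]
            intro e
            exact hc1' _ _ (hTn _ ((hsup u).1 hu)) (hTn _ ((hsup v).1 hv)) (hom h)
              (Finset.singleton_injective e)
          common_neighbor := by
            intro p₀ p₁ p₂ hp y h0 h1 h2 e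
            have hy : y ∉ P'.support := by
              rw [hp]
              simp [h0.ne, h1.ne, h2.ne]
            have h5 := hL5 y hy
            rw [e, hL1 p₀ (by rw [hp]; simp), hL1 p₁ (by rw [hp]; simp),
              hL1 p₂ (by rw [hp]; simp)] at h5
            have k1 := Finset.card_union_le ({c₁ (f p₀)} ∪ {c₁ (f p₁)} : Finset ℕ) {c₁ (f p₂)}
            have k2 := Finset.card_union_le ({c₁ (f p₀)} : Finset ℕ) {c₁ (f p₁)}
            simp only [Finset.card_singleton] at k1 k2
            omega
          not_colorable := hncol }
      have h1 : C.n + C.G.edgeSet.ncard ≤ m + H.edgeSet.ncard := hmin.1 C'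
      have h2 : H.edgeSet.ncard ≤ (C.G.edgeSet \ {s(c, r)}).ncard :=
        ncard_edges_le f hf _ (Set.toFinite _) (fun u v h => ⟨h.1, h.2⟩)
      have h3 : (C.G.edgeSet \ {s(c, r)}).ncard < C.G.edgeSet.ncard :=
        Set.ncard_sdiff_singleton_lt_of_mem hca (Set.toFinite _)
      have h4 : m ≤ C.n := by
        simpa using Fintype.card_le_of_injective f hf
      omega
    obtain ⟨c₂, hc2, hc2'⟩ := hcol
    have hval : ∀ i, (if h : ∃ j, f j = f i then c₂ h.choose else 0) = c₂ i := by
      intro i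
      have h : ∃ j, f j = f i := ⟨i, rfl⟩
      rw [dif_pos h, hf h.choose_spec]
    refine ⟨fun v => if h : ∃ i, f i = v then c₂ h.choose else 0, ?_, ?_, ?_⟩
    · intro v hv
      obtain ⟨i, rfl⟩ := hinv v (Or.inl hv)
      simp only [hval]
      have := hc2 i
      rwa [hL5' i (fun h => hTn _ ((hsup i).1 h) hv)] at this
    · intro v hv
      obtain ⟨i, rfl⟩ := hinv v (Or.inr hv)
      simp only [hval]
      have := hc2 i
      rwa [hL1 i ((hsup i).2 hv), Finset.mem_singleton] at this
    · intro u v hu hv huv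
      obtain ⟨i, rfl⟩ := hinv u (Or.inl hu)
      obtain ⟨j, rfl⟩ := hinv v hv
      simp only [hval]
      apply hc2'
      refine ⟨huv, ?_⟩
      rw [Ne, Sym2.eq_iff]
      rintro (⟨h, -⟩ | ⟨h, -⟩)
      · exact hTn _ (by simp [h]) hu
      · exact hTn _ (by simp [h]) hu
  obtain ⟨c₂, hc2, hc2T, hc2'⟩ := step2
  have hmix : ∀ u v, C.D.pos u ∈ enclosed J → C.G.Adj u v →
      (C.D.pos v ∈ enclosed J ∨ (v = r ∨ v = b ∨ v = c)) := by
    intro u v hu huv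
    rcases edge_from_enclosed C.D C.plane hab hbc hca huv hu (tgt_mem C.D huv) with h | h
    · exact Or.inr (vertex_on_tri C.D hab hbc hca h)
    · exact Or.inl h
  apply C.not_colorable
  let φ : Fin C.n → ℕ := fun v => if C.D.pos v ∈ enclosed J then c₂ v else c₁ v
  have main : ∀ u v, C.D.pos u ∈ enclosed J → C.G.Adj u v → φ u ≠ φ v := by
    intro u v hu huv
    have h := hmix u v hu huv
    have h1 := hc2' u v hu h huv
    rcases h with h | h
    · simpa [φ, hu, h] using h1
    · have h2 := hTn v h
      rw [hc2T v h] at h1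
      simpa [φ, hu, h2] using h1
  refine ⟨φ, ?_, ?_⟩
  · intro v
    by_cases hv : C.D.pos v ∈ enclosed J
    · simpa [φ, hv] using hc2 v hv
    · simpa [φ, hv] using hc1 v hv
  · intro u v huv
    by_cases hu : C.D.pos u ∈ enclosed J
    · exact main u v hu huv
    by_cases hv : C.D.pos v ∈ enclosed J
    · exact (main v u hv huv.symm).symm
    simpa [φ, hu, hv] using hc1' u v hu hv huv
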